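/- Indicator-to-function lemma. Let φ(z) = Σ_{i≥0} c_i z^i be given by a power series and let ε ∈ (0, 1/𝔠_s(φ,1)) be such that 𝔠_ε(φ,1) < ∞. Then there exists a function h : ℝ² → [−𝔠_ε(φ,1), 𝔠_ε(φ,1)] which is 𝔠_ε(φ,1)-Lipschitz continuous in its first coordinate, such that: (a) for every x₁ ∈ [−1,1], | E_{α₁,β₁,b₀ i.i.d. N(0,1)}[ 1{α₁x₁ + β₁√(1−x₁²) + b₀ ≥ 0}·h(α₁,b₀) ] − φ(x₁) | ≤ ε; equivalently (b) for every d ≥ 1 and every w*, x ∈ ℝ^d with ‖w*‖₂ = ‖x‖₂ = 1, | E_{w∼N(0,I_d), b₀∼N(0,1)}[ 1{⟨w,x⟩ + b₀ ≥ 0}·h(⟨w,w*⟩, b₀) ] − φ(⟨w*,x⟩) | ≤ ε. Furthermore, E_{α₁,b₀∼N(0,1)}[ h(α₁,b₀)² ] ≤ 𝔠_s(φ,1)². -/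

import Mathlib

open MeasureTheory ProbabilityTheory
open scoped BigOperators

/-- The sufficiently large absolute constant `C*` (taken to be `10⁴`). -/
noncomputable def Cstar : ℝ := 10 ^ 4

/-- The value `φ(z) = ∑ᵢ cᵢ zⁱ` of the power series with coefficients `c`. -/
noncomputable def psVal (c : ℕ → ℝ) (z : ℝ) : ℝ := ∑' i, c i * z ^ i

/-- The summand of the sample-complexity measure `𝔠_s(φ,R)`. -/
noncomputable def csSummand (c : ℕ → ℝ) (R : ℝ) (i : ℕ) : ℝ :=
  ((i : ℝ) + 1) ^ (1.75 : ℝ) * R ^ i * |c i|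

/-- Sample complexity `𝔠_s(φ,R) = C* ∑ᵢ (i+1)^{1.75} Rⁱ |cᵢ|`. -/
noncomputable def csOf (c : ℕ → ℝ) (R : ℝ) : ℝ := Cstar * ∑' i, csSummand c R i

/-- The summand of the size-complexity measure `𝔠_ε(φ,R)`. -/
noncomputable def ceSummand (c : ℕ → ℝ) (R ε : ℝ) (i : ℕ) : ℝ :=
  ((Cstar * R) ^ i
      + (Real.sqrt (Real.log (1 / ε)) / Real.sqrt i * (Cstar * R)) ^ i) * |c i|

/-- Size complexity `𝔠_ε(φ,R) = ∑ᵢ ((C*R)ⁱ + (√(log(1/ε))/√i · C*R)ⁱ) |cᵢ|`. -/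
noncomputable def ceOf (c : ℕ → ℝ) (R ε : ℝ) : ℝ := ∑' i, ceSummand c R ε i

namespace ITF
open Polynomial

/-- Probabilists' Hermite polynomials over the reals. -/
noncomputable def H : ℕ → ℝ[X]
  | 0 => 1
  | n + 1 => X * H n - derivative (H n)

lemma H_zero : H 0 = 1 := rfl
lemma H_succ (n : ℕ) : H (n + 1) = X * H n - derivative (H n) := rfl

lemma deriv_H (n : ℕ) : derivative (H (n + 1)) = ((n : ℝ[X]) + 1) * H n := by
  induction n with
  | zero => simp [H_succ, H_zero]
  | succ k ih =>
    have h2 : derivative (derivative (H (k+1))) = ((k : ℝ[X]) + 1) * derivative (H k) := by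
      rw [ih]; simp
    rw [H_succ (k+1), derivative_sub, derivative_mul, h2, derivative_X, ih]
    have := H_succ k
    rw [this]; push_cast; ring

/-- value of the Hermite polynomial -/
noncomputable def He (n : ℕ) (x : ℝ) : ℝ := (H n).eval x

lemma He_zero (x : ℝ) : He 0 x = 1 := by simp [He, H_zero]
lemma He_one (x : ℝ) : He 1 x = x := by simp [He, H_succ, H_zero]
lemma He_rec (n : ℕ) (x : ℝ) : He (n+2) x = x * He (n+1) x - (n+1) * He n x := by
  simp [He, H_succ (n+1), deriv_H]

lemma hasDerivAt_He (n : ℕ) (x : ℝ) : HasDerivAt (He (n+1)) ((n+1) * He n x) x := by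
  have := (H (n+1)).hasDerivAt x
  rw [deriv_H] at this
  simp only [eval_mul, eval_add, eval_natCast, eval_one] at this
  exact this

lemma hasDerivAt_He' (n : ℕ) (x : ℝ) : HasDerivAt (He n) (n * He (n-1) x) x := by
  cases n with
  | zero =>
    have h : He 0 = fun _ => (1:ℝ) := funext He_zero
    rw [h]; simpa using hasDerivAt_const x (1:ℝ)
  | succ n => simpa using hasDerivAt_He n x

lemma He_succ_eq (n : ℕ) (x : ℝ) : He (n+1) x = x * He n x - n * He (n-1) x := by
  cases n with
  | zero => simp [He_zero, He_one]
  | succ n => rw [He_rec]; push_cast; simp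

lemma continuous_He (n : ℕ) : Continuous (He n) := (H n).continuous

lemma He_neg_eq (n : ℕ) (x : ℝ) : He n (-x) = (-1)^n * He n x := by
  induction n using Nat.twoStepInduction with
  | zero => simp [He_zero]
  | one => simp [He_one]
  | more n h1 h2 => rw [He_rec, He_rec, h1, h2]; ring

/-- growth bound -/
lemma He_bound (B : ℝ) (hB : 0 < B) (n : ℕ) (hn : (n : ℝ) ≤ 2 * B^2 + 1) (a : ℝ) (ha : |a| ≤ B) :
    |He n a| ≤ (2*B)^n := by
  induction n using Nat.twoStepInduction with
  | zero => simp [He_zero]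
  | one => simp [He_one]; linarith
  | more n h1 h2 =>
    have hn' : (n:ℝ) + 1 ≤ 2 * B^2 := by push_cast at hn; linarith
    have h1 := h1 (by linarith)
    have h2 := h2 (by push_cast; linarith)
    rw [He_rec]
    calc |a * He (n+1) a - (n+1) * He n a| ≤ |a * He (n+1) a| + |(n+1) * He n a| := abs_sub _ _
      _ = |a| * |He (n+1) a| + (n+1) * |He n a| := by
        rw [abs_mul, abs_mul, abs_of_nonneg (by positivity : (0:ℝ) ≤ n+1)]
      _ ≤ B * (2*B)^(n+1) + (2*B^2) * (2*B)^n := by gcongr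
      _ = (2*B)^(n+2) := by ring

/-- energy lower bound at 0 -/
lemma energy_zero (n : ℕ) :
    ((n+1).factorial : ℝ) ≤ ((n:ℝ)+1) * He (n+1) 0 ^2 + ((n+1) * He n 0)^2 := by
  induction n using Nat.twoStepInduction with
  | zero => simp [He_zero, He_one]
  | one => simp [He_zero, He_one, He_rec]; norm_num [Nat.factorial]
  | more n h1 h2 =>
    rw [He_rec (n+1), He_rec n, show n+2+1 = (n+1+1)+1 from rfl, Nat.factorial_succ,
      Nat.factorial_succ (n+1)]
    push_cast
    have h3 : ((n:ℝ)+3) * ((n+2) * (n+1).factorial) ≤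
       (n+3) * ((n+2) * (((n:ℝ)+1) * He (n+1) 0 ^2 + ((n+1) * He n 0)^2)) := by gcongr
    have h4 : 0 ≤ ((n:ℝ)+3) * (n+2) * He (n+1) 0 ^ 2 := by positivity
    have h5 : 0 ≤ ((n:ℝ)+3) * ((n+1) * He n 0)^2 := by positivity
    have h6 : ((n:ℝ)+2+1) * ((n+1+1) * (n+1).factorial) = 
      ((n:ℝ)+3) * ((n+2) * (n+1).factorial) := by ring
    rw [h6]
    refine h3.trans ?_
    nlinarith [h4, h5]

lemma hasDerivAt_z (n : ℕ) (x : ℝ) : HasDerivAt (fun x => ((n:ℝ)+1) * He n x)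
    (x * ((n+1) * He n x) - (n+1) * He (n+1) x) x := by
  have := (hasDerivAt_He' n x).const_mul ((n:ℝ)+1)
  refine this.congr_deriv ?_
  rw [He_succ_eq n x]; ring

lemma energy (n : ℕ) (x : ℝ) :
    ((n+1).factorial : ℝ) ≤ ((n:ℝ)+1) * He (n+1) x ^2 + ((n+1) * He n x)^2 := by
  have key : ∀ x : ℝ, 0 ≤ x → 
     ((n+1).factorial : ℝ) ≤ ((n:ℝ)+1) * He (n+1) x ^2 + ((n+1) * He n x)^2 := by
    intro x hx
    refine (energy_zero n).trans ?_
    let F := fun x : ℝ => ((n:ℝ)+1) * He (n+1) x ^2 + ((n+1) * He n x)^2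
    have hd : ∀ x, HasDerivAt F (2 * x * ((n+1) * He n x)^2) x := by
      intro x
      have h1 := ((hasDerivAt_He n x).pow 2).const_mul ((n:ℝ)+1)
      have h2 := (hasDerivAt_z n x).pow 2
      refine (h1.add h2).congr_deriv ?_
      push_cast; ring
    have hm : MonotoneOn F (Set.Ici 0) := by
      refine monotoneOn_of_deriv_nonneg (convex_Ici 0) 
        (fun x _ => (hd x).continuousAt.continuousWithinAt)
        (fun x _ => (hd x).differentiableAt.differentiableWithinAt) ?_
      intro x hx
      rw [interior_Ici] at hx
      rw [(hd x).deriv]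
      have : (0:ℝ) < x := hx
      positivity
    exact hm (Set.mem_Ici.2 le_rfl) hx hx
  rcases le_total 0 x with hx | hx
  · exact key x hx
  · have := key (-x) (by linarith)
    rw [He_neg_eq, He_neg_eq] at this
    have e1 : ((-1:ℝ)^(n+1) * He (n+1) x)^2 = He (n+1) x ^2 := by
      rw [mul_pow, ← pow_mul, mul_comm, pow_mul']; simp
    have e2 : (((n:ℝ)+1) * ((-1:ℝ)^n * He n x))^2 = ((n+1) * He n x)^2 := by
      rw [mul_left_comm, mul_pow, ← pow_mul, mul_comm, pow_mul']; simp
    rwa [e1, e2] at this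

/-- `L²` mass of Hermite polynomials on `[-1,1]`. -/
noncomputable def NN (n : ℕ) : ℝ := ∫ x in (-1:ℝ)..1, He n x ^ 2

lemma NN_lower (n : ℕ) : (16/15) * (n.factorial : ℝ) / (3 * n + 25) ≤ NN n := by
  cases n with
  | zero => simp [NN, He_zero]; norm_num
  | succ n =>
    rw [div_le_iff₀ (by positivity)]
    set m : ℝ := (n:ℝ)+1 with hm
    have hm0 : 0 ≤ m := by positivity
    let f := fun x : ℝ => (1-x^2)^2 * (He (n+1) x * (m * He n x))
    let f' := fun x : ℝ => (2*(1-x^2)*(-(2*x))) * (He (n+1) x * (m * He n x)) + 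
      (1-x^2)^2 * ((m * He n x) * (m * He n x) + 
        He (n+1) x * (x * (m * He n x) - m * He (n+1) x))
    have hd : ∀ x, HasDerivAt f (f' x) x := by
      intro x
      have h1 : HasDerivAt (fun x : ℝ => (1-x^2)^2) (2*(1-x^2)*(-(2*x))) x := by
        have := ((hasDerivAt_pow 2 x).const_sub 1).pow 2
        refine this.congr_deriv ?_
        simp
      exact h1.mul ((hasDerivAt_He n x).mul (hasDerivAt_z n x))
    have c1 := continuous_He (n+1)
    have c2 := continuous_He n
    have hc : Continuous f' := by fun_prop
    have hi := intervalIntegral.integral_eq_sub_of_hasDerivAt (a := -1) (b := 1) (fun x _ => hd x)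
      (hc.intervalIntegrable _ _)
    have hf0 : f 1 - f (-1) = 0 := by simp [f]
    rw [hf0] at hi
    let g := fun x : ℝ => (1-x^2)^2 * ((n+1).factorial : ℝ) - (3*m+25) * He (n+1) x ^2
    have hcg : Continuous g := by fun_prop
    have hle : ∫ x in (-1:ℝ)..1, g x ≤ ∫ x in (-1:ℝ)..1, 2 * f' x := by
      refine intervalIntegral.integral_mono_on (by norm_num) (hcg.intervalIntegrable _ _)
        ((by fun_prop : Continuous fun x => 2 * f' x).intervalIntegrable _ _) ?_
      intro x hx
      have he := energy n x
      simp only [g, f']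
      rw [← hm] at he
      generalize He (n+1) x = y at *
      generalize m * He n x = z at *
      have hs0 : 0 ≤ 1 - x^2 := by nlinarith [hx.1, hx.2]
      have hs1 : 1 - x^2 ≤ 1 := by nlinarith [hx.1, hx.2]
      set s := 1 - x^2 with hs
      have hr : (-4*x + x * s)^2 ≤ 25 := by
        have : -4*x + x*s = -(x * (4 - s)) := by ring
        have h7 : x^2 = 1 - s := by rw [hs]; ring
        rw [this, neg_sq, mul_pow, h7]; nlinarith
      have hsq : 0 ≤ (s * z + (-4*x + x*s) * y)^2 := sq_nonneg _
      have hy : (-4*x + x * s)^2 * y^2 ≤ 25 * y^2 := by gcongr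
      have hs2 : s^2 ≤ 1 := by nlinarith
      have hmy : s^2 * (m * y^2) ≤ 1 * (m*y^2) := by gcongr
      have hF : s^2 * ((n+1).factorial:ℝ) ≤ s^2 * (m * y^2 + z^2) := by gcongr
      nlinarith
    rw [intervalIntegral.integral_const_mul, hi, mul_zero, intervalIntegral.integral_sub,
      intervalIntegral.integral_mul_const, intervalIntegral.integral_const_mul] at hle
    · have h16 : ∫ x in (-1:ℝ)..1, (1-x^2)^2 = 16/15 := by
        have : ∀ x:ℝ, (1-x^2)^2 = 1 - 2*x^2 + x^4 := fun x => by ring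
        simp_rw [this]
        rw [intervalIntegral.integral_add, intervalIntegral.integral_sub,
          intervalIntegral.integral_const_mul, integral_pow, integral_pow]
        · norm_num
        all_goals exact Continuous.intervalIntegrable (by fun_prop) _ _
      rw [h16] at hle
      simp only [NN]; push_cast; rw [← hm]; linarith
    all_goals exact Continuous.intervalIntegrable (by fun_prop) _ _

/-- the standard Gaussian measure -/
noncomputable abbrev G : Measure ℝ := gaussianReal 0 1
/-- the standard Gaussian density -/
noncomputable abbrev ph : ℝ → ℝ := gaussianPDFReal 0 1

lemma ph_eq (x : ℝ) : ph x = (Real.sqrt (2 * Real.pi))⁻¹ * Real.exp (-(x^2) / 2) := by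
  simp [ph, gaussianPDFReal]

lemma ph_neg (x : ℝ) : ph (-x) = ph x := by simp [ph_eq]

lemma ph_pos (x : ℝ) : 0 < ph x := gaussianPDFReal_pos 0 1 x one_ne_zero

lemma hasDerivAt_ph (x : ℝ) : HasDerivAt ph (-(x * ph x)) x := by
  have h1 : HasDerivAt (fun x : ℝ => (Real.sqrt (2 * Real.pi))⁻¹ * Real.exp (-(x^2) / 2))
      ((Real.sqrt (2 * Real.pi))⁻¹ * (Real.exp (-(x^2) / 2) * (-x))) x := by
    refine (HasDerivAt.exp ?_).const_mul _
    have := ((hasDerivAt_pow 2 x).neg).div_const 2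
    refine this.congr_deriv ?_
    simp; ring
  have h2 : ph = fun x : ℝ => (Real.sqrt (2 * Real.pi))⁻¹ * Real.exp (-(x^2) / 2) := funext ph_eq
  rw [h2]
  refine h1.congr_deriv ?_
  ring

lemma continuous_ph : Continuous ph :=
  continuous_iff_continuousAt.2 fun x => (hasDerivAt_ph x).continuousAt

lemma integral_G (f : ℝ → ℝ) : ∫ x, f x ∂G = ∫ x, ph x * f x := by
  simpa using integral_gaussianReal_eq_integral_smul (μ := 0) (v := 1) (f := f) one_ne_zero

lemma integrable_G (f : ℝ → ℝ) : Integrable f G ↔ Integrable (fun x => ph x * f x) := by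
  rw [G, gaussianReal_of_var_ne_zero _ one_ne_zero, integrable_withDensity_iff
    (measurable_gaussianPDF _ _) (Filter.Eventually.of_forall fun _ => gaussianPDF_lt_top)]
  simp_rw [toReal_gaussianPDF, mul_comm]

lemma integrable_poly (p : ℝ[X]) : Integrable (fun x => p.eval x) G := by
  induction p using Polynomial.induction_on' with
  | add p q hp hq =>
    simp_rw [eval_add]
    exact hp.add hq
  | monomial n a =>
    simp only [eval_monomial]
    refine Integrable.const_mul ?_ a
    have := memLp_id_gaussianReal (μ := 0) (v := 1) n
    have h2 := this.integrable_norm_pow'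
    simp only [id] at h2
    refine h2.mono (by fun_prop) ?_
    simp

lemma integrable_of_poly (p : ℝ[X]) {f : ℝ → ℝ} (h : ∀ x, f x = p.eval x) : Integrable f G := by
  rw [show f = fun x => p.eval x from funext h]; exact integrable_poly p

lemma stein (p : ℝ[X]) : ∫ x, x * p.eval x ∂G = ∫ x, (derivative p).eval x ∂G := by
  have h1 : ∀ x, HasDerivAt (fun x => ph x * p.eval x) 
      (ph x * (derivative p).eval x - ph x * (x * p.eval x)) x := by
    intro x
    refine ((hasDerivAt_ph x).mul (p.hasDerivAt x)).congr_deriv ?_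
    ring
  have i1 := (integrable_G _).1 (integrable_poly (derivative p))
  have i2 : Integrable (fun x => ph x * (x * p.eval x)) := by
    have := (integrable_G _).1 (integrable_poly (X * p))
    simpa using this
  have := integral_eq_zero_of_hasDerivAt_of_integrable h1 (i1.sub i2)
    ((integrable_G _).1 (integrable_poly p))
  rw [integral_sub i1 i2] at this
  rw [integral_G, integral_G]; linarith

lemma integral_He_sq (n : ℕ) : ∫ x, He n x ^ 2 ∂G = n.factorial := by
  induction n with
  | zero => simp [He_zero]
  | succ n ih =>
    have h := stein (H n * H (n+1))
    rw [derivative_mul, deriv_H] at h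
    have e1 : ∀ x, He (n+1) x ^2 = x * eval x (H n * H (n+1)) - 
       eval x (derivative (H n) * H (n+1)) := by
      intro x
      simp only [He, sq]
      nth_rw 1 [H_succ]
      simp; ring
    have i1 : Integrable (fun x => x * eval x (H n * H (n+1))) G := by
      exact integrable_of_poly (X * (H n * H (n+1))) (by simp)
    simp_rw [e1]
    rw [integral_sub i1 (integrable_poly _), h]
    simp_rw [eval_add]
    rw [integral_add (integrable_poly _) (integrable_poly _), add_sub_cancel_left]
    have e2 : ∀ x, eval x (H n * (((n:ℝ[X])+1) * H n)) = (n+1) * He n x ^ 2 := by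
      intro x; simp [He]; ring
    simp_rw [e2]
    rw [integral_const_mul, ih, Nat.factorial_succ]; push_cast; ring

lemma hermite_tail (n : ℕ) (b : ℝ) :
    ∫ x, (if 0 ≤ x + b then He (n+1) x else 0) ∂G = ph b * He n (-b) := by
  rw [integral_G]
  have h1 : ∀ x, HasDerivAt (fun x => -(ph x * He n x)) (ph x * He (n+1) x) x := by
    intro x
    refine ((hasDerivAt_ph x).mul (hasDerivAt_He' n x)).neg.congr_deriv ?_
    rw [He_succ_eq]; ring
  have i1 : Integrable (fun x => ph x * He (n+1) x) := (integrable_G _).1 (integrable_poly _)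
  have i0 : Integrable (fun x => -(ph x * He n x)) := ((integrable_G _).1 (integrable_poly _)).neg
  have ht := tendsto_zero_of_hasDerivAt_of_integrableOn_Ioi (a := -b) (fun x _ => h1 x)
     i1.integrableOn i0.integrableOn
  have := integral_Ioi_of_hasDerivAt_of_tendsto' (a := -b) (fun x _ => h1 x) i1.integrableOn ht
  rw [← integral_Ici_eq_integral_Ioi, ← integral_indicator measurableSet_Ici] at this
  rw [ph_neg] at this
  have e : ∀ x, ph x * (if 0 ≤ x + b then He (n+1) x else 0) = 
     (Set.Ici (-b)).indicator (fun x => ph x * He (n+1) x) x := by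
    intro x
    by_cases hx : 0 ≤ x + b
    · rw [Set.indicator_of_mem (by simp; linarith)]; simp [hx]
    · rw [Set.indicator_of_notMem (by simp; linarith)]; simp [hx]
  simp_rw [e]
  rw [this]; ring

lemma mehler (ρ s : ℝ) (hs : ρ^2 + s^2 = 1) (n : ℕ) (g : ℝ) :
    ∫ b, He n (g * ρ + b * s) ∂G = ρ^n * He n g := by
  have ip : ∀ p : ℝ[X], Integrable (fun b => p.eval (g * ρ + b * s)) G := by
    intro p
    exact integrable_of_poly (p.comp (C (g*ρ) + C s * X)) (by intro x; simp [mul_comm x s])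
  have st : ∀ n, ∫ b, b * He (n+1) (g * ρ + b * s) ∂G = 
      s * (n+1) * ∫ b, He n (g*ρ + b * s) ∂G := by
    intro n
    have := stein ((H (n+1)).comp (C (g*ρ) + C s * X))
    simp only [derivative_comp, deriv_H] at this
    simp at this
    rw [← integral_const_mul]
    simp only [He]
    simp_rw [mul_comm _ s]
    rw [this]
    congr 1; ext x; ring
  induction n using Nat.twoStepInduction with
  | zero => simp [He_zero]
  | one =>
    simp [He_one]
    rw [integral_add (integrable_const _)]
    · rw [integral_mul_const (μ := G) s (fun x => x), integral_id_gaussianReal]; simp; ring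
    · exact integrable_of_poly (X * C s) (by intro x; simp [mul_comm x s])
  | more n h1 h2 =>
    have e : ∀ b, He (n+2) (g*ρ+b*s) = (g * ρ) * He (n+1) (g*ρ+b*s) + 
       (s * (b * He (n+1) (g*ρ+b*s)) - (n+1) * He n (g*ρ+b*s)) := by
      intro b; rw [He_rec]; ring
    have i1 : Integrable (fun b => (g * ρ) * He (n+1) (g*ρ+b*s)) G := (ip _).const_mul _
    have i3 : Integrable (fun b => ((n:ℝ)+1) * He n (g*ρ+b*s)) G := (ip _).const_mul _
    have i2 : Integrable (fun b => (s * (b * He (n+1) (g*ρ+b*s)))) G := by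
      refine Integrable.const_mul ?_ _
      exact integrable_of_poly (X * (H (n+1)).comp (C (g*ρ) + C s * X)) 
        (by intro x; simp [He, mul_comm x s])
    simp_rw [e]
    rw [integral_add i1 (show Integrable (fun b => s * (b * He (n+1) (g*ρ+b*s)) -
      (n+1) * He n (g*ρ+b*s)) G from i2.sub i3), integral_sub i2 i3, integral_const_mul, integral_const_mul,
      integral_const_mul, st, h1, h2, He_rec]
    have : s^2 = 1 - ρ^2 := by linarith
    ring_nf
    rw [this]; ring

/-- The bivariate Gaussian with unit variances and correlation `ρ`. -/
noncomputable def muR (ρ s : ℝ) : Measure (ℝ × ℝ) :=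
  (G.prod G).map (fun p : ℝ × ℝ => (p.1 * ρ + p.2 * s, p.1))

lemma cf_G (t : ℝ) : ∫ x, Complex.exp (((t * x : ℝ) : ℂ) * Complex.I) ∂G = 
    Complex.exp (-((t^2/2 : ℝ) : ℂ)) := by
  have := charFun_gaussianReal (μ := 0) (v := 1) t
  rw [charFun_apply_real] at this
  push_cast
  rw [this]; congr 1; push_cast; simp

lemma cf_GG (a b : ℝ) : ∫ p : ℝ × ℝ, Complex.exp (((a * p.1 + b * p.2 : ℝ) : ℂ) * Complex.I)
    ∂(G.prod G) = Complex.exp (-(((a^2+b^2)/2 : ℝ) : ℂ)) := by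
  have e : ∀ p : ℝ × ℝ, Complex.exp (((a * p.1 + b * p.2 : ℝ) : ℂ) * Complex.I) = 
     Complex.exp (((a * p.1 : ℝ) : ℂ) * Complex.I) * Complex.exp (((b * p.2 : ℝ) : ℂ) * Complex.I) := by
    intro p; rw [← Complex.exp_add]; congr 1; push_cast; ring
  simp_rw [e]
  rw [integral_prod_mul (fun x : ℝ => Complex.exp (((a * x : ℝ) : ℂ) * Complex.I))
    (fun x : ℝ => Complex.exp (((b * x : ℝ) : ℂ) * Complex.I)), cf_G, cf_G, ← Complex.exp_add]
  congr 1; push_cast; ring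

lemma cf_pi {d : ℕ} (t : Fin d → ℝ) : 
    ∫ v : Fin d → ℝ, Complex.exp (((∑ j, t j * v j : ℝ) : ℂ) * Complex.I)
    ∂(Measure.pi fun _ : Fin d => G) = Complex.exp (-(((∑ j, t j ^2)/2 : ℝ) : ℂ)) := by
  have e : ∀ v : Fin d → ℝ, Complex.exp (((∑ j, t j * v j : ℝ) : ℂ) * Complex.I) = 
     ∏ j, Complex.exp (((t j * v j : ℝ) : ℂ) * Complex.I) := by
    intro p; rw [← Complex.exp_sum, ← Finset.sum_mul]; congr 1; push_cast; rfl
  simp_rw [e]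
  rw [integral_fintype_prod_eq_prod (fun j (x : ℝ) => Complex.exp (((t j * x : ℝ) : ℂ) * Complex.I))]
  simp_rw [cf_G]
  rw [← Complex.exp_sum]
  congr 1; push_cast; rw [Finset.sum_neg_distrib, Finset.sum_div]

lemma dual_prod (L : StrongDual ℝ (ℝ × ℝ)) (u v : ℝ) : L (u, v) = L (1,0) * u + L (0,1) * v := by
  have : (u, v) = u • ((1:ℝ),(0:ℝ)) + v • ((0:ℝ),(1:ℝ)) := by simp
  rw [this, map_add, map_smul, map_smul]; simp [mul_comm]

lemma cf_muR (ρ s : ℝ) (hs : ρ^2 + s^2 = 1) (L : StrongDual ℝ (ℝ × ℝ)) :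
    charFunDual (muR ρ s) L = Complex.exp (-(((L (1,0)^2 + L (0,1)^2 + 2 * ρ * L (1,0) * L (0,1))/2 : ℝ) : ℂ)) := by
  rw [charFunDual_apply, muR, integral_map (by fun_prop) (by fun_prop)]
  have e : ∀ p : ℝ × ℝ, L (p.1 * ρ + p.2 * s, p.1) = 
      (L (1,0) * ρ + L (0,1)) * p.1 + (L (1,0) * s) * p.2 := by
    intro p; rw [dual_prod]; ring
  simp_rw [e]
  rw [cf_GG]
  congr 4
  have : s^2 = 1 - ρ^2 := by linarith
  rw [mul_pow, this]; ring

instance (ρ s : ℝ) : IsProbabilityMeasure (muR ρ s) :=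
  Measure.isProbabilityMeasure_map (by fun_prop)

lemma law_a (ρ s : ℝ) (hs : ρ^2 + s^2 = 1) :
    (G.prod G).map (fun p : ℝ × ℝ => (p.1, p.1 * ρ + p.2 * s)) = muR ρ s := by
  have : IsProbabilityMeasure ((G.prod G).map (fun p : ℝ × ℝ => (p.1, p.1 * ρ + p.2 * s))) :=
    Measure.isProbabilityMeasure_map (by fun_prop)
  refine Measure.ext_of_charFunDual ?_
  ext L
  rw [cf_muR ρ s hs, charFunDual_apply, integral_map (by fun_prop) (by fun_prop)]
  have e : ∀ p : ℝ × ℝ, L (p.1, p.1 * ρ + p.2 * s) = 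
      (L (1,0) + L (0,1) * ρ) * p.1 + (L (0,1) * s) * p.2 := by
    intro p; rw [dual_prod]; ring
  simp_rw [e]
  rw [cf_GG]
  congr 4
  have : s^2 = 1 - ρ^2 := by linarith
  rw [mul_pow, this]; ring

lemma law_b {d : ℕ} (w x : Fin d → ℝ) (hw : ∑ j, w j ^ 2 = 1) (hx : ∑ j, x j ^ 2 = 1)
    (s : ℝ) (hs : (∑ j, w j * x j)^2 + s^2 = 1) :
    (Measure.pi fun _ : Fin d => G).map (fun v => (∑ j, v j * w j, ∑ j, v j * x j)) = 
      muR (∑ j, w j * x j) s := by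
  have : IsProbabilityMeasure ((Measure.pi fun _ : Fin d => G).map 
      (fun v => (∑ j, v j * w j, ∑ j, v j * x j))) :=
    Measure.isProbabilityMeasure_map (by fun_prop)
  refine Measure.ext_of_charFunDual ?_
  ext L
  rw [cf_muR _ s hs, charFunDual_apply, integral_map (by fun_prop) (by fun_prop)]
  have e : ∀ v : Fin d → ℝ, L (∑ j, v j * w j, ∑ j, v j * x j) = 
      ∑ j, (L (1,0) * w j + L (0,1) * x j) * v j := by
    intro p
    rw [dual_prod, Finset.mul_sum, Finset.mul_sum, ← Finset.sum_add_distrib]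
    refine Finset.sum_congr rfl fun j _ => ?_
    ring
  simp_rw [e]
  rw [cf_pi]
  congr 4
  have e2 : ∀ j, (L (1,0) * w j + L (0,1) * x j)^2 = 
    L (1,0)^2 * w j ^2 + L (0,1)^2 * x j ^2 + 2 * L (1,0) * L (0,1) * (w j * x j) := by
    intro j; ring
  simp_rw [e2]
  rw [Finset.sum_add_distrib, Finset.sum_add_distrib, ← Finset.mul_sum, ← Finset.mul_sum,
    ← Finset.mul_sum, hw, hx]; ring

lemma muR_fst (ρ s : ℝ) (hs : ρ^2 + s^2 = 1) : (muR ρ s).map Prod.fst = G := by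
  rw [← law_a ρ s hs, Measure.map_map (by fun_prop) (by fun_prop)]
  have : (Prod.fst ∘ fun p : ℝ × ℝ => (p.1, p.1 * ρ + p.2 * s)) = Prod.fst := rfl
  rw [this, Measure.map_fst_prod]; simp

lemma muR_snd (ρ s : ℝ) : (muR ρ s).map Prod.snd = G := by
  rw [muR, Measure.map_map (by fun_prop) (by fun_prop)]
  have : (Prod.snd ∘ fun p : ℝ × ℝ => (p.1 * ρ + p.2 * s, p.1)) = Prod.fst := rfl
  rw [this, Measure.map_fst_prod]; simp

/-- the core functional -/
noncomputable def J (ρ s : ℝ) (h : ℝ → ℝ → ℝ) : ℝ := 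
  ∫ p : (ℝ × ℝ) × ℝ, (if 0 ≤ p.1.2 + p.2 then h p.1.1 p.2 else 0) ∂((muR ρ s).prod G)

lemma meas_ite (h : ℝ → ℝ → ℝ) (hm : Measurable (Function.uncurry h)) :
    Measurable (fun p : (ℝ × ℝ) × ℝ => if 0 ≤ p.1.2 + p.2 then h p.1.1 p.2 else 0) := by
  refine Measurable.ite (measurableSet_le (by fun_prop) (by fun_prop)) ?_ measurable_const
  exact hm.comp (by fun_prop : Measurable fun p : (ℝ × ℝ) × ℝ => (p.1.1, p.2))

lemma J_map {Ω : Type*} [MeasurableSpace Ω] (ν : Measure Ω) [SFinite ν] {E : Type*} 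
    [MeasurableSpace E] (f : Ω → E) (hf : Measurable f)
    (F : E × ℝ → ℝ) (hF : Measurable F) :
    ∫ p, F p ∂((ν.map f).prod G) = ∫ p : Ω × ℝ, F (f p.1, p.2) ∂(ν.prod G) := by
  have e : (ν.map f).prod G = (ν.prod G).map (Prod.map f id) := by
    rw [← Measure.map_prod_map ν G hf measurable_id, Measure.map_id]
  rw [e, integral_map (by fun_prop) hF.aestronglyMeasurable]
  rfl

lemma J_a (ρ s : ℝ) (hs : ρ^2 + s^2 = 1) (h : ℝ → ℝ → ℝ) (hm : Measurable (Function.uncurry h)) :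
    ∫ v : ℝ × ℝ × ℝ, (if 0 ≤ v.1 * ρ + v.2.1 * s + v.2.2 then h v.1 v.2.2 else 0)
      ∂(G.prod (G.prod G)) = J ρ s h := by
  rw [J, ← law_a ρ s hs, ← (measurePreserving_prodAssoc G G G).integral_comp'
    (g := fun v : ℝ × ℝ × ℝ => (if 0 ≤ v.1 * ρ + v.2.1 * s + v.2.2 then h v.1 v.2.2 else 0)),
    J_map _ _ (by fun_prop) _ (meas_ite h hm)]
  rfl

lemma J_b {d : ℕ} (w x : Fin d → ℝ) (hw : ∑ j, w j ^ 2 = 1) (hx : ∑ j, x j ^ 2 = 1)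
    (s : ℝ) (hs : (∑ j, w j * x j)^2 + s^2 = 1)
    (h : ℝ → ℝ → ℝ) (hm : Measurable (Function.uncurry h)) :
    ∫ v : (Fin d → ℝ) × ℝ,
            (if 0 ≤ (∑ j, v.1 j * x j) + v.2 then h (∑ j, v.1 j * w j) v.2 else 0)
            ∂((Measure.pi fun _ : Fin d => G).prod G) = J (∑ j, w j * x j) s h := by
  rw [J, ← law_b w x hw hx s hs, J_map _ _ (by fun_prop) _ (meas_ite h hm)]

lemma J_const (ρ s : ℝ) : J ρ s (fun _ _ => 2) = 1 := by
  have hF : Measurable (fun p : ℝ × ℝ => if 0 ≤ p.1 + p.2 then (2:ℝ) else 0) :=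
    Measurable.ite (measurableSet_le (by fun_prop) (by fun_prop)) measurable_const measurable_const
  have h1 : J ρ s (fun _ _ => 2) = ∫ p : ℝ × ℝ, (if 0 ≤ p.1 + p.2 then (2:ℝ) else 0) ∂(G.prod G) := by
    have := J_map (muR ρ s) Prod.snd measurable_snd _ hF
    rw [muR_snd] at this
    rw [this]
    rfl
  have hneg : G.map (fun x => -x) = G := by simp [G, gaussianReal_map_neg]
  have h2 : ∫ p : ℝ × ℝ, (if 0 ≤ p.1 + p.2 then (2:ℝ) else 0) ∂(G.prod G) = 
      ∫ p : ℝ × ℝ, (if 0 ≤ -p.1 + -p.2 then (2:ℝ) else 0) ∂(G.prod G) := by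
    have e : (G.prod G) = (G.prod G).map (Prod.map (fun x => -x) (fun x => -x)) := by
      rw [← Measure.map_prod_map G G measurable_neg measurable_neg, hneg]
    conv_lhs => rw [e]
    rw [integral_map (by fun_prop) hF.aestronglyMeasurable]
    rfl
  have hnull : ∀ᵐ p ∂(G.prod G), p.1 + p.2 ≠ 0 := by
    have hc : (G.prod G).map (fun p : ℝ × ℝ => p.1 + p.2) = gaussianReal 0 2 := by
      have := gaussianReal_conv_gaussianReal (m₁ := 0) (m₂ := 0) (v₁ := 1) (v₂ := 1)
      rw [Measure.conv] at this
      rw [this]; norm_num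
    have := nullSingletonClass_gaussianReal (μ := 0) (v := 2) (by norm_num)
    have h0 : ∀ᵐ x ∂(gaussianReal 0 2), x ≠ 0 := by
      rw [ae_iff]; simp
    rw [← hc] at h0
    exact ae_of_ae_map (f := fun p : ℝ × ℝ => p.1 + p.2) (p := fun x => x ≠ 0) (by fun_prop) h0
  have hF' : Measurable (fun p : ℝ × ℝ => if 0 ≤ -p.1 + -p.2 then (2:ℝ) else 0) :=
    Measurable.ite (measurableSet_le (by fun_prop) (by fun_prop)) measurable_const measurable_const
  have i1 : Integrable (fun p : ℝ × ℝ => if 0 ≤ p.1 + p.2 then (2:ℝ) else 0) (G.prod G) :=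
    Integrable.of_bound hF.aestronglyMeasurable 2 (Filter.Eventually.of_forall fun p => by
      split_ifs <;> simp)
  have i2 : Integrable (fun p : ℝ × ℝ => if 0 ≤ -p.1 + -p.2 then (2:ℝ) else 0) (G.prod G) :=
    Integrable.of_bound hF'.aestronglyMeasurable 2 (Filter.Eventually.of_forall fun p => by
      split_ifs <;> simp)
  have h3 := integral_add i1 i2
  have h4 : ∫ p : ℝ × ℝ, ((if 0 ≤ p.1 + p.2 then (2:ℝ) else 0) + (if 0 ≤ -p.1 + -p.2 then (2:ℝ) else 0))
      ∂(G.prod G) = ∫ p : ℝ × ℝ, (2:ℝ) ∂(G.prod G) := by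
    refine integral_congr_ae ?_
    filter_upwards [hnull] with p hp
    rcases lt_or_gt_of_ne hp with h | h
    · rw [if_neg (by linarith), if_pos (by linarith)]; simp
    · rw [if_pos (by linarith), if_neg (by linarith)]; simp
  rw [h4, ← h2, ← h1] at h3
  simp at h3
  linarith

lemma J_He (ρ s : ℝ) (hs : ρ^2 + s^2 = 1) (n : ℕ) (q : ℝ → ℝ) (hqm : Measurable q)
    (hq : Integrable q G) :
    J ρ s (fun a b => He (n+1) a * q b) = ρ^(n+1) * ∫ b, q b * (ph b * He n (-b)) ∂G := by
  have hHm : Measurable (He (n+1)) := (continuous_He _).measurable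
  have hm : Measurable (Function.uncurry (fun a b => He (n+1) a * q b)) := 
    (hHm.comp measurable_fst).mul (hqm.comp measurable_snd)
  have iH : Integrable (fun p : ℝ × ℝ => He (n+1) (p.1 * ρ + p.2 * s)) (G.prod G) := by
    have h1 : Integrable (He (n+1)) ((muR ρ s).map Prod.fst) := by
      rw [muR_fst ρ s hs]; exact integrable_poly _
    have h2 := h1.comp_measurable measurable_fst
    rw [muR] at h2
    exact h2.comp_measurable (by fun_prop)
  rw [J, muR, J_map _ _ (by fun_prop) _ (meas_ite _ hm)]
  have iP : Integrable (fun p : (ℝ × ℝ) × ℝ => 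
      if 0 ≤ p.1.1 + p.2 then He (n+1) (p.1.1 * ρ + p.1.2 * s) * q p.2 else 0) ((G.prod G).prod G) := by
    have := (iH.mul_prod hq).indicator (s := {p : (ℝ × ℝ) × ℝ | 0 ≤ p.1.1 + p.2})
      (measurableSet_le (by fun_prop) (by fun_prop))
    refine this.congr (Filter.Eventually.of_forall fun p => ?_)
    simp [Set.indicator_apply]
  rw [integral_prod_symm _ iP, ← integral_const_mul]
  congr 1; ext b
  have iQ : Integrable (fun p : ℝ × ℝ => 
      if 0 ≤ p.1 + b then He (n+1) (p.1 * ρ + p.2 * s) * q b else 0) (G.prod G) := by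
    have := (iH.mul_const (q b)).indicator (s := {p : ℝ × ℝ | 0 ≤ p.1 + b})
      (measurableSet_le (by fun_prop) (by fun_prop))
    refine this.congr (Filter.Eventually.of_forall fun p => ?_)
    simp [Set.indicator_apply]
  simp only
  rw [integral_prod _ iQ]
  have e : ∀ x : ℝ, ∫ y, (if 0 ≤ x + b then He (n+1) (x * ρ + y * s) * q b else 0) ∂G = 
     (ρ^(n+1) * q b) * (if 0 ≤ x + b then He (n+1) x else 0) := by
    intro x
    by_cases hx : 0 ≤ x + b
    · simp only [hx, if_true]
      rw [integral_mul_const, mehler ρ s hs]; ring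
    · simp [hx]
  simp_rw [e]
  rw [integral_const_mul, hermite_tail]; ring

/-- clamping to `[-B,B]` -/
noncomputable def cl (B a : ℝ) : ℝ := max (-B) (min B a)

lemma continuous_cl (B : ℝ) : Continuous (cl B) := by unfold cl; fun_prop

lemma cl_abs (B : ℝ) (hB : 0 ≤ B) (a : ℝ) : |cl B a| ≤ B := by
  rw [abs_le]; unfold cl
  exact ⟨le_max_left _ _, max_le (by linarith) (min_le_left _ _)⟩

lemma cl_of_abs_le (B a : ℝ) (h : |a| ≤ B) : cl B a = a := by
  rw [abs_le] at h
  simp [cl, h.1, h.2]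

lemma cl_lip (B a a' : ℝ) : |cl B a - cl B a'| ≤ |a - a'| := by
  unfold cl
  refine (abs_max_sub_max_le_max _ _ _ _).trans ?_
  refine max_le (by simp) ((abs_min_sub_min_le_max _ _ _ _).trans ?_)
  simp

/-- the tail envelope -/
noncomputable def tl (B : ℝ) (i : ℕ) (a : ℝ) : ℝ := if |a| ≤ B then 0 else (2*|a|)^i

lemma meas_tl (B : ℝ) (i : ℕ) : Measurable (tl B i) :=
  Measurable.ite (measurableSet_le (by fun_prop) (by fun_prop)) (by fun_prop) (by fun_prop)

lemma tl_diff (B : ℝ) (hB : 0 < B) (i : ℕ) (hi : (i:ℝ) ≤ 2*B^2+1) (a : ℝ) :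
    (He i a - He i (cl B a))^2 ≤ 4 * tl B i a ^2 ∧ He i (cl B a)^2 ≤ He i a^2 + tl B i a ^ 2 := by
  by_cases h : |a| ≤ B
  · rw [cl_of_abs_le B a h]; simp [tl, h]
  · simp only [tl, h, if_false]
    push Not at h
    have h1 := He_bound |a| (hB.trans h) i (hi.trans (by gcongr)) a le_rfl
    have h2 := (He_bound B hB i hi (cl B a) (cl_abs B hB.le a)).trans
      (show (2*B)^i ≤ (2*|a|)^i by gcongr)
    have h3 : |He i a - He i (cl B a)| ≤ 2 * (2*|a|)^i := (abs_sub _ _).trans (by linarith)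
    constructor
    · calc _ ≤ (2 * (2*|a|)^i)^2 := sq_le_sq' (by linarith [(abs_le.1 h3).1]) (abs_le.1 h3).2
        _ = _ := by ring
    · have : He i (cl B a)^2 ≤ ((2*|a|)^i)^2 := sq_le_sq' (by linarith [(abs_le.1 h2).1]) (abs_le.1 h2).2
      nlinarith [sq_nonneg (He i a)]

lemma exp_quarter : Integrable (fun a : ℝ => Real.exp (a^2/4)) G ∧ 
    ∫ a, Real.exp (a^2/4) ∂G = Real.sqrt 2 := by
  have e : ∀ x, ph x * Real.exp (x^2/4) = (Real.sqrt (2 * Real.pi))⁻¹ * Real.exp (-(1/4) * x^2) := by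
    intro x
    rw [ph_eq, mul_assoc, ← Real.exp_add]; congr 2; ring
  constructor
  · rw [integrable_G]; simp_rw [e]
    exact (integrable_exp_neg_mul_sq (by norm_num)).const_mul _
  · rw [integral_G]; simp_rw [e]
    rw [integral_const_mul, integral_gaussian, ← Real.sqrt_inv, ← Real.sqrt_mul (by positivity)]
    congr 1
    field_simp; norm_num

lemma tl_sq (ε : ℝ) (hε : 0 < ε) (i : ℕ) (B : ℝ) (hB0 : 0 < B)
    (hB : B^2 = 32 * (i + Real.log (1/ε))) :
    Integrable (fun a => tl B i a ^2) G ∧ ∫ a, tl B i a ^2 ∂G ≤ 1.5 * i.factorial * ε^4 := by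
  have hpt : ∀ a, tl B i a ^2 ≤ (i.factorial * ε^4) * Real.exp (a^2/4) := by
    intro a
    by_cases h : |a| ≤ B
    · simp only [tl, h, if_true]; rw [zero_pow two_ne_zero]; positivity
    · simp only [tl, h, if_false]
      push Not at h
      have hBa : B^2 ≤ a^2 := by rw [← sq_abs a]; gcongr
      have h1 : (a^2/8)^i ≤ i.factorial * Real.exp (a^2/8) := by
        have := Real.pow_div_factorial_le_exp (a^2/8) (by positivity) i
        rw [div_le_iff₀ (by positivity)] at this
        linarith
      have h2 : ((2*|a|)^i)^2 = 32^i * (a^2/8)^i := by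
        have : (2*|a|)^2 = 32*(a^2/8) := by rw [mul_pow, sq_abs]; ring
        rw [← pow_mul, mul_comm i 2, pow_mul, this, mul_pow]
      have h3 : (32:ℝ)^i ≤ Real.exp (4 * i) := by
        rw [mul_comm, Real.exp_nat_mul]
        gcongr
        have : Real.exp 4 = Real.exp 1 ^ 4 := by rw [← Real.exp_nat_mul]; norm_num
        rw [this]
        calc (32:ℝ) ≤ 2.7^4 := by norm_num
          _ ≤ _ := by gcongr; linarith [Real.exp_one_gt_d9]
      have h4 : ε^4 = Real.exp (-(4 * Real.log (1/ε))) := by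
        rw [one_div, Real.log_inv, mul_neg, neg_neg, ← Real.log_rpow hε, Real.exp_log (by positivity)]
        norm_cast
      calc ((2*|a|)^i)^2 ≤ Real.exp (4*i) * (i.factorial * Real.exp (a^2/8)) := by
            rw [h2]; gcongr
        _ = (i.factorial * (Real.exp (4*i) * Real.exp (a^2/8))) := by ring
        _ ≤ (i.factorial * (Real.exp (-(4 * Real.log (1/ε))) * Real.exp (a^2/4))) := by
            rw [← Real.exp_add, ← Real.exp_add]
            refine mul_le_mul_of_nonneg_left (Real.exp_le_exp.2 ?_) (by positivity)
            linarith
        _ = _ := by rw [h4]; ring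
  have hi : Integrable (fun a => (i.factorial * ε^4) * Real.exp (a^2/4)) G := exp_quarter.1.const_mul _
  have hint : Integrable (fun a => tl B i a ^2) G := by
    refine hi.mono' ((meas_tl B i).pow_const 2).aestronglyMeasurable 
      (Filter.Eventually.of_forall fun a => ?_)
    rw [Real.norm_of_nonneg (by positivity)]; exact hpt a
  refine ⟨hint, (integral_mono hint hi hpt).trans ?_⟩
  rw [integral_const_mul, exp_quarter.2]
  have : Real.sqrt 2 ≤ 1.5 := by rw [Real.sqrt_le_left (by norm_num)]; norm_num
  calc _ ≤ (i.factorial * ε^4) * 1.5 := by gcongr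
    _ = _ := by ring

lemma integrable_He_sq (n : ℕ) : Integrable (fun x => He n x ^2) G :=
  integrable_of_poly (H n ^ 2) (by simp [He])

lemma trunc (ε : ℝ) (hε : 0 < ε) (hε1 : ε ≤ 1) (i : ℕ) (B : ℝ) (hB0 : 0 < B)
    (hB : B^2 = 32 * (i + Real.log (1/ε))) :
    Integrable (fun a => (He i a - He i (cl B a))^2) G ∧ Integrable (fun a => He i (cl B a)^2) G ∧ 
    ∫ a, (He i a - He i (cl B a))^2 ∂G ≤ 6 * i.factorial * ε^4 ∧ 
    ∫ a, He i (cl B a)^2 ∂G ≤ 2.5 * i.factorial := by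
  have hL : 0 ≤ Real.log (1/ε) := Real.log_nonneg (by rw [le_div_iff₀ hε]; linarith)
  have hi : (i:ℝ) ≤ 2*B^2+1 := by rw [hB]; have : (0:ℝ) ≤ i := by positivity
                                  linarith
  obtain ⟨t1, t2⟩ := tl_sq ε hε i B hB0 hB
  have c1 := continuous_He i
  have c2 := continuous_cl B
  have d := tl_diff B hB0 i hi
  have i1 : Integrable (fun a => (He i a - He i (cl B a))^2) G := by
    refine (t1.const_mul 4).mono' (by fun_prop) (Filter.Eventually.of_forall fun a => ?_)
    rw [Real.norm_of_nonneg (by positivity)]; exact (d a).1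
  have i2 : Integrable (fun a => He i (cl B a)^2) G := by
    refine ((integrable_He_sq i).add t1).mono' (by fun_prop) (Filter.Eventually.of_forall fun a => ?_)
    rw [Real.norm_of_nonneg (by positivity)]; exact (d a).2
  refine ⟨i1, i2, ?_, ?_⟩
  · have := integral_mono i1 (t1.const_mul 4) (fun a => (d a).1)
    rw [integral_const_mul] at this; linarith
  · have := integral_mono i2 ((integrable_He_sq i).add t1) (fun a => (d a).2)
    simp only [Pi.add_apply] at this
    rw [integral_add (integrable_He_sq i) t1, integral_He_sq] at this
    have h4 : ε^4 ≤ 1 := pow_le_one₀ hε.le hε1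
    have : (i.factorial : ℝ) * ε^4 ≤ i.factorial * 1 := by gcongr
    linarith

/-- normalised `b`-factor -/
noncomputable def q (n : ℕ) (b : ℝ) : ℝ := 
  if b ∈ Set.Ioc (-1:ℝ) 1 then He n (-b) / (ph b)^2 / NN n else 0

lemma NN_pos (n : ℕ) : 0 < NN n := lt_of_lt_of_le (by positivity) (NN_lower n)

lemma meas_q (n : ℕ) : Measurable (q n) := by
  have := (continuous_He n).measurable
  have := continuous_ph.measurable
  exact Measurable.ite measurableSet_Ioc (by fun_prop) measurable_const

lemma ph_low (b : ℝ) (hb : b ∈ Set.Ioc (-1:ℝ) 1) : 1/17.1 ≤ ph b ^2 := by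
  have e : ph b ^2 = 1 / (2 * Real.pi * Real.exp (b^2)) := by
    rw [ph_eq, mul_pow, inv_pow, Real.sq_sqrt (by positivity), ← Real.exp_nat_mul, one_div, mul_inv (2 * Real.pi) (Real.exp (b^2)),
      ← Real.exp_neg]
    congr 2; push_cast; ring
  rw [e]
  have h1 : Real.exp (b^2) ≤ Real.exp 1 := Real.exp_le_exp.2 (by nlinarith [hb.1, hb.2])
  have h2 := Real.exp_one_lt_d9
  have h3 := Real.pi_lt_d4
  refine one_div_le_one_div_of_le (by positivity) ?_
  calc 2 * Real.pi * Real.exp (b^2) ≤ 2 * 3.1416 * 2.7182818286 := by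
        gcongr; linarith
    _ ≤ _ := by norm_num

lemma He_neg_sq (n : ℕ) (x : ℝ) : He n (-x)^2 = He n x^2 := by
  rw [He_neg_eq, mul_pow, ← pow_mul, mul_comm, pow_mul']; simp

lemma q_norm (n : ℕ) : ∫ b, q n b * (ph b * He n (-b)) ∂G = 1 := by
  rw [integral_G]
  have e : ∀ b, ph b * (q n b * (ph b * He n (-b))) = 
     (Set.Ioc (-1:ℝ) 1).indicator (fun b => He n b^2 / NN n) b := by
    intro b
    by_cases hb : b ∈ Set.Ioc (-1:ℝ) 1
    · rw [Set.indicator_of_mem hb, q, if_pos hb, ← He_neg_sq]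
      have := (ph_pos b).ne'
      have := (NN_pos n).ne'
      field_simp
    · rw [Set.indicator_of_notMem hb, q, if_neg hb]; simp
  simp_rw [e]
  rw [integral_indicator measurableSet_Ioc, ← intervalIntegral.integral_of_le (by norm_num),
    intervalIntegral.integral_div]
  exact div_self (NN_pos n).ne'

lemma q_bound (n : ℕ) (b : ℝ) : |q n b| ≤ 17.1 * (2 * Real.sqrt (n+1))^n / NN n := by
  have hN := NN_pos n
  by_cases hb : b ∈ Set.Ioc (-1:ℝ) 1
  · rw [q, if_pos hb, abs_div, abs_of_pos hN, abs_div, abs_of_pos (pow_pos (ph_pos b) 2)]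
    have h1 := ph_low b hb
    have hs : Real.sqrt ((n:ℝ)+1)^2 = n + 1 := Real.sq_sqrt (by positivity)
    have h1s : 1 ≤ Real.sqrt ((n:ℝ)+1) := by
      rw [Real.one_le_sqrt]; have : (0:ℝ) ≤ n := by positivity
      linarith
    have h2 : |He n (-b)| ≤ (2 * Real.sqrt (n+1))^n := by
      refine He_bound _ (by positivity) n (by rw [hs]; have : (0:ℝ) ≤ n := by positivity
                                              linarith) _ ?_
      rw [abs_neg]; refine (abs_le.2 ⟨hb.1.le, hb.2⟩).trans h1s
    gcongr
    rw [div_le_iff₀ (pow_pos (ph_pos b) 2)]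
    calc |He n (-b)| ≤ (2 * Real.sqrt (n+1))^n := h2
      _ = 17.1 * (2 * Real.sqrt (n+1))^n * (1/17.1) := by ring
      _ ≤ _ := by gcongr
  · rw [q, if_neg hb]; simp; positivity

lemma integrable_q (n : ℕ) : Integrable (q n) G :=
  Integrable.of_bound (meas_q n).aestronglyMeasurable _ 
    (Filter.Eventually.of_forall fun b => q_bound n b)

lemma integrable_q_sq (n : ℕ) : Integrable (fun b => q n b^2) G :=
  Integrable.of_bound ((meas_q n).pow_const 2).aestronglyMeasurable 
    ((17.1 * (2 * Real.sqrt (n+1))^n / NN n)^2)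
    (Filter.Eventually.of_forall fun b => by
      rw [norm_pow]; gcongr; exact q_bound n b)

lemma q_sq (n : ℕ) : ∫ b, q n b ^2 ∂G ≤ 86 / NN n := by
  have hN := NN_pos n
  have i1 := (integrable_G _).1 (integrable_q_sq n)
  rw [integral_G]
  have e : ∀ b, ph b * q n b^2 ≤ 
     (Set.Ioc (-1:ℝ) 1).indicator (fun b => He n b^2 * (86 / NN n ^2)) b := by
    intro b
    by_cases hb : b ∈ Set.Ioc (-1:ℝ) 1
    · rw [Set.indicator_of_mem hb, q, if_pos hb, ← He_neg_sq]
      have h1 := ph_low b hb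
      have hp := ph_pos b
      have h5 : 1/5 ≤ ph b := by
        by_contra hcon; push Not at hcon
        have : ph b ^2 < (1/5)^2 := by gcongr
        norm_num at this h1; linarith
      have h3 : 1/86 ≤ ph b ^3 := by
        calc (1/86:ℝ) ≤ (1/17.1) * (1/5) := by norm_num
          _ ≤ ph b ^2 * ph b := by gcongr
          _ = _ := by ring
      have : ph b * (He n (-b) / ph b ^2 / NN n)^2 = He n (-b)^2 * ((1/ph b^3) / NN n^2) := by
        field_simp
      rw [this]
      gcongr
      rw [div_le_iff₀ (by positivity)]; linarith
    · rw [Set.indicator_of_notMem hb, q, if_neg hb]; simp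
  have hc := continuous_He n
  have i2 : IntegrableOn (fun b => He n b^2 * (86 / NN n ^2)) (Set.Ioc (-1:ℝ) 1) := by
    exact (Continuous.integrableOn_Icc (by fun_prop)).mono_set Set.Ioc_subset_Icc_self
  refine (integral_mono i1 (i2.integrable_indicator measurableSet_Ioc) e).trans ?_
  rw [integral_indicator measurableSet_Ioc, ← intervalIntegral.integral_of_le (by norm_num),
    intervalIntegral.integral_mul_const]
  refine le_of_eq ?_
  change NN n * (86 / NN n ^2) = _
  field_simp

/-- truncation level -/
noncomputable def BB (ε : ℝ) (i : ℕ) : ℝ := Real.sqrt (32 * (i + Real.log (1/ε)))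

/-- building blocks -/
noncomputable def hh (ε : ℝ) : ℕ → ℝ → ℝ → ℝ
  | 0 => fun _ _ => 2
  | n+1 => fun a b => He (n+1) (cl (BB ε (n+1)) a) * q n b

lemma log_nn {ε : ℝ} (hε : 0 < ε) (hε1 : ε ≤ 1) : 0 ≤ Real.log (1/ε) :=
  Real.log_nonneg (by rw [le_div_iff₀ hε]; linarith)

lemma BB_sq {ε : ℝ} (hε : 0 < ε) (hε1 : ε ≤ 1) (i : ℕ) :
    BB ε i ^2 = 32 * (i + Real.log (1/ε)) := by
  have := log_nn hε hε1
  exact Real.sq_sqrt (by positivity)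

lemma BB_one {ε : ℝ} (hε : 0 < ε) (hε1 : ε ≤ 1) (n : ℕ) : 1 ≤ BB ε (n+1) := by
  have := log_nn hε hε1
  rw [BB, Real.one_le_sqrt]; push_cast
  have : (0:ℝ) ≤ n := by positivity
  linarith

lemma pow_self_le (n : ℕ) : ((n:ℝ)+1)^n ≤ 3^n * n.factorial := by
  induction n with
  | zero => simp
  | succ n ih =>
    have hp : (0:ℝ) < (n:ℝ)+1 := by positivity
    have h1 : ((n:ℝ)+2)^(n+1) ≤ 3 * ((n:ℝ)+1)^(n+1) := by
      have h2 : ((n:ℝ)+2) = (1/((n:ℝ)+1) + 1) * ((n:ℝ)+1) := by field_simp; ring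
      have h3 : (1/((n:ℝ)+1) + 1)^(n+1) ≤ 3 := by
        calc (1/((n:ℝ)+1) + 1)^(n+1) ≤ (Real.exp (1/((n:ℝ)+1)))^(n+1) := by
              gcongr; exact Real.add_one_le_exp _
          _ = Real.exp 1 := by
              rw [← Real.exp_nat_mul]; congr 1; push_cast; field_simp
          _ ≤ 3 := by linarith [Real.exp_one_lt_d9]
      rw [h2, mul_pow]; gcongr
    rw [Nat.factorial_succ]; push_cast
    calc ((n:ℝ)+1+1)^(n+1) = ((n:ℝ)+2)^(n+1) := by ring
      _ ≤ 3 * ((n:ℝ)+1)^(n+1) := h1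
      _ = 3 * (((n:ℝ)+1)^n * ((n:ℝ)+1)) := by ring
      _ ≤ 3 * ((3^n * n.factorial) * ((n:ℝ)+1)) := by gcongr
      _ = _ := by ring

lemma inv_NN (n : ℕ) : 1 / NN n ≤ (15/16) * (3*n+25) / n.factorial := by
  have h := NN_lower n
  have hN := NN_pos n
  rw [div_le_div_iff₀ hN (by positivity)]
  rw [div_le_iff₀ (by positivity)] at h
  linarith

lemma cube_le (n : ℕ) : ((n:ℝ)+1)^3 ≤ 8^n := by
  have h : ((n:ℝ)+1) ≤ 2^n := by
    have := Nat.lt_two_pow_self (n := n)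
    exact_mod_cast this
  calc ((n:ℝ)+1)^3 ≤ (2^n)^3 := by gcongr
    _ = 8^n := by rw [← pow_mul, mul_comm, pow_mul]; norm_num

lemma size_bound {ε : ℝ} (hε : 0 < ε) (hε1 : ε ≤ 1) (n : ℕ) :
    (n+1) * (2 * BB ε (n+1))^(n+1) * (17.1 * (2 * Real.sqrt (n+1))^n / NN n) ≤
      (10^4:ℝ)^(n+1) + (Real.sqrt (Real.log (1/ε)) / Real.sqrt (n+1) * 10^4)^(n+1) := by
  have hL := log_nn hε hε1
  set L := Real.log (1/ε) with hLd
  set X := Real.sqrt ((n:ℝ)+1) with hX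
  set Y := Real.sqrt L with hY
  have hY0 : 0 ≤ Y := Real.sqrt_nonneg _
  have hX1 : 1 ≤ X := by
    rw [hX, Real.one_le_sqrt]; have : (0:ℝ) ≤ n := by positivity
    linarith
  have hX0 : 0 < X := by linarith
  have hXs : X^2 = n+1 := Real.sq_sqrt (by positivity)
  have hYs : Y^2 = L := Real.sq_sqrt hL
  have hB : 2 * BB ε (n+1) ≤ 11.32 * (X + Y) := by
    have : BB ε (n+1) ≤ 5.66 * (X+Y) := by
      rw [BB, Real.sqrt_le_left (by positivity), ← hLd]
      push_cast
      nlinarith [mul_nonneg hX0.le hY0, sq_nonneg X, sq_nonneg Y]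
    linarith
  have hBn : 0 ≤ 2 * BB ε (n+1) := by have := BB_one hε hε1 n; linarith
  set r := Y / X with hr
  have hr0 : 0 ≤ r := by positivity
  have hYr : Y = r * X := by rw [hr]; field_simp
  have h1 : (2 * BB ε (n+1))^(n+1) ≤ 11.32^(n+1) * (2^n * (1 + r^(n+1)) * X^(n+1)) := by
    calc _ ≤ (11.32 * (X+Y))^(n+1) := by gcongr
      _ = 11.32^(n+1) * (X+Y)^(n+1) := mul_pow _ _ _
      _ ≤ 11.32^(n+1) * (2^n * (X^(n+1) + Y^(n+1))) := by
          gcongr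
          have := add_pow_le hX0.le hY0 (n+1)
          simpa using this
      _ = _ := by rw [hYr]; ring
  have h2 : X^(n+1) * X^n ≤ ((n:ℝ)+1) * (3^n * n.factorial) := by
    calc X^(n+1) * X^n ≤ X^(n+1) * X^(n+1) := by
          gcongr
          exact Nat.le_succ n
      _ = (X^2)^(n+1) := by ring
      _ = ((n:ℝ)+1) * ((n:ℝ)+1)^n := by rw [hXs]; ring
      _ ≤ _ := by gcongr; exact pow_self_le n
  have h3 := inv_NN n
  have hN := NN_pos n
  have hf : (0:ℝ) < n.factorial := by positivity
  have h4 : ((n:ℝ)+1)^2 * (3*n+25) ≤ 25 * 8^n := by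
    have := cube_le n
    have h0 : (0:ℝ) ≤ n := by positivity
    nlinarith [sq_nonneg ((n:ℝ)+1), mul_nonneg h0 (sq_nonneg ((n:ℝ)+1))]
  calc (n+1) * (2 * BB ε (n+1))^(n+1) * (17.1 * (2 * X)^n / NN n)
      = (n+1) * (2 * BB ε (n+1))^(n+1) * (17.1 * (2 * X)^n) * (1 / NN n) := by ring
    _ ≤ (n+1) * (11.32^(n+1) * (2^n * (1 + r^(n+1)) * X^(n+1))) * (17.1 * (2 * X)^n) * 
        ((15/16) * (3*n+25) / n.factorial) := by gcongr
    _ = (n+1) * (11.32^(n+1) * (2^n * (1 + r^(n+1)))) * (17.1 * 2^n) * 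
        ((15/16) * (3*n+25) / n.factorial) * (X^(n+1) * X^n) := by rw [mul_pow 2 X]; ring
    _ ≤ (n+1) * (11.32^(n+1) * (2^n * (1 + r^(n+1)))) * (17.1 * 2^n) * 
        ((15/16) * (3*n+25) / n.factorial) * (((n:ℝ)+1) * (3^n * n.factorial)) := by gcongr
    _ = 11.32^(n+1) * 2^n * 2^n * 3^n * (17.1 * (15/16)) * (1 + r^(n+1)) * (((n:ℝ)+1)^2 * (3*n+25)) := by
        field_simp
    _ ≤ 11.32^(n+1) * 2^n * 2^n * 3^n * (17.1 * (15/16)) * (1 + r^(n+1)) * (25 * 8^n) := by gcongr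
    _ = (11.32 * (17.1 * (15/16)) * 25) * (11.32 * 2 * 2 * 3 * 8)^n * (1 + r^(n+1)) := by
        simp only [mul_pow, pow_succ]; ring
    _ ≤ 10^4 * (10^4)^n * (1 + r^(n+1)) := by gcongr <;> norm_num
    _ = _ := by rw [mul_pow]; ring

lemma He_lip (B : ℝ) (hB : 1 ≤ B) (n : ℕ) (hn : (n:ℝ) + 1 ≤ 2*B^2+1) (x y : ℝ) (hx : |x| ≤ B) (hy : |y| ≤ B) :
    |He (n+1) x - He (n+1) y| ≤ (n+1) * (2*B)^n * |x - y| := by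
  have := Convex.norm_image_sub_le_of_norm_hasDerivWithin_le (f := He (n+1)) 
    (f' := fun x => ((n+1:ℕ):ℝ) * He n x) (s := Set.Icc (-B) B) (C := (n+1) * (2*B)^n) (x := y) (y := x)
    (fun z _ => by have := hasDerivAt_He' (n+1) z; simpa using this.hasDerivWithinAt) 
    (fun z hz => by
      rw [norm_mul]
      have h1 := He_bound B (by linarith) n (by linarith) z (abs_le.2 hz)
      simp only [Real.norm_eq_abs, Nat.abs_cast]; push_cast
      gcongr) (convex_Icc _ _) (abs_le.1 hy) (abs_le.1 hx)
  simpa using this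

lemma hh_sup {ε : ℝ} (hε : 0 < ε) (hε1 : ε ≤ 1) (i : ℕ) (a b : ℝ) :
    |hh ε i a b| ≤ (10^4:ℝ)^i + (Real.sqrt (Real.log (1/ε)) / Real.sqrt i * 10^4)^i := by
  cases i with
  | zero => simp [hh]; norm_num
  | succ n =>
    have hB := BB_one hε hε1 n
    have hL := log_nn hε hε1
    have hq := q_bound n b
    have hH := He_bound (BB ε (n+1)) (by linarith) (n+1) (by
      rw [BB_sq hε hε1]; push_cast; have : (0:ℝ) ≤ n := by positivity
      linarith) _ (cl_abs _ (by linarith) a)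
    refine le_trans ?_ ((size_bound hε hε1 n).trans (le_of_eq (by push_cast; rfl)))
    rw [hh, abs_mul]
    have hn : (0:ℝ) ≤ n := by positivity
    refine mul_le_mul (hH.trans ?_) hq (abs_nonneg _) (by positivity)
    exact le_mul_of_one_le_left (by positivity) (by linarith)

lemma hh_lip {ε : ℝ} (hε : 0 < ε) (hε1 : ε ≤ 1) (i : ℕ) (a a' b : ℝ) :
    |hh ε i a b - hh ε i a' b| ≤ 
      ((10^4:ℝ)^i + (Real.sqrt (Real.log (1/ε)) / Real.sqrt i * 10^4)^i) * |a - a'| := by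
  cases i with
  | zero => simp [hh]
  | succ n =>
    have hB := BB_one hε hε1 n
    have hL := log_nn hε hε1
    have hq := q_bound n b
    have hn : (0:ℝ) ≤ n := by positivity
    have hH := He_lip (BB ε (n+1)) hB n (by
      rw [BB_sq hε hε1]; push_cast
      linarith) _ _ (cl_abs _ (by linarith) a) (cl_abs _ (by linarith) a')
    have hc := cl_lip (BB ε (n+1)) a a'
    have hN := NN_pos n
    have hs := size_bound hε hε1 n
    rw [hh, ← sub_mul, abs_mul]
    calc _ ≤ ((n+1) * (2*BB ε (n+1))^n * |a - a'|) * (17.1 * (2 * Real.sqrt (n+1))^n / NN n) := by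
          refine mul_le_mul (hH.trans ?_) hq (abs_nonneg _) (by positivity)
          gcongr
      _ ≤ ((n+1) * (2*BB ε (n+1))^(n+1) * |a - a'|) * (17.1 * (2 * Real.sqrt (n+1))^n / NN n) := by
          gcongr
          · linarith
          · exact Nat.le_succ n
      _ = ((n+1) * (2*BB ε (n+1))^(n+1) * (17.1 * (2 * Real.sqrt (n+1))^n / NN n)) * |a - a'| := by ring
      _ ≤ _ := by
          refine mul_le_mul_of_nonneg_right (hs.trans (le_of_eq (by push_cast; rfl))) (abs_nonneg _)

lemma meas_hh (ε : ℝ) (i : ℕ) : Measurable (Function.uncurry (hh ε i)) := by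
  cases i with
  | zero => exact measurable_const
  | succ n =>
    have h1 := ((continuous_He (n+1)).comp (continuous_cl (BB ε (n+1)))).measurable
    exact (h1.comp measurable_fst).mul ((meas_q n).comp measurable_snd)

lemma hh_sq {ε : ℝ} (hε : 0 < ε) (hε1 : ε ≤ 1) (i : ℕ) :
    ∫ v : ℝ × ℝ, (hh ε i v.1 v.2)^2 ∂(G.prod G) ≤ (10^4 * ((i:ℝ)+1))^2 := by
  cases i with
  | zero => simp [hh]; norm_num
  | succ n =>
    have hB := BB_one hε hε1 n
    obtain ⟨-, -, -, h⟩ := trunc ε hε hε1 (n+1) (BB ε (n+1)) (by linarith) (BB_sq hε hε1 _)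
    have e : ∀ v : ℝ × ℝ, (hh ε (n+1) v.1 v.2)^2 = He (n+1) (cl (BB ε (n+1)) v.1) ^2 * (q n v.2)^2 := by
      intro v; rw [hh, mul_pow]
    simp_rw [e]
    rw [integral_prod_mul (fun x => He (n+1) (cl (BB ε (n+1)) x) ^2) (fun y => (q n y)^2)]
    have h3 := inv_NN n
    have hN := NN_pos n
    have hn : (0:ℝ) ≤ n := by positivity
    calc _ ≤ (2.5 * ((n+1).factorial : ℝ)) * (86 / NN n) := 
          mul_le_mul h (q_sq n) (integral_nonneg fun _ => by positivity) (by positivity)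
      _ = (2.5 * ((n+1).factorial : ℝ)) * 86 * (1 / NN n) := by ring
      _ ≤ (2.5 * ((n+1).factorial : ℝ)) * 86 * ((15/16) * (3*n+25) / n.factorial) := by gcongr
      _ = 2.5 * (n+1) * 86 * ((15/16) * (3*n+25)) := by
          rw [Nat.factorial_succ]; push_cast; field_simp
      _ ≤ _ := by push_cast; nlinarith

lemma J_err (ρ s : ℝ) (hs : ρ^2 + s^2 = 1) (D Q : ℝ → ℝ) (hD : Measurable D) (hQ : Measurable Q)
    (iD : Integrable (fun a => D a^2) G) (iQ : Integrable (fun a => Q a^2) G) (l : ℝ) (hl : 0 < l) :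
    Integrable (fun p : (ℝ × ℝ) × ℝ => if 0 ≤ p.1.2 + p.2 then D p.1.1 * Q p.2 else 0) ((muR ρ s).prod G) ∧ 
    |J ρ s (fun a b => D a * Q b)| ≤ (l * ∫ a, D a^2 ∂G + (∫ b, Q b^2 ∂G) / l)/2 := by
  have T1 : MeasurePreserving (fun p : (ℝ × ℝ) × ℝ => p.1.1) ((muR ρ s).prod G) G :=
    MeasurePreserving.comp (μb := muR ρ s) ⟨measurable_fst, muR_fst ρ s hs⟩ measurePreserving_fst
  have T2 : MeasurePreserving (fun p : (ℝ × ℝ) × ℝ => p.2) ((muR ρ s).prod G) G :=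
    measurePreserving_snd
  have i1 := (T1.integrable_comp_of_integrable iD).const_mul (l/2)
  have i2 := (T2.integrable_comp_of_integrable iQ).const_mul (1/(2*l))
  have hm : Measurable (Function.uncurry (fun a b => D a * Q b)) :=
    (hD.comp measurable_fst).mul (hQ.comp measurable_snd)
  have bd : ∀ p : (ℝ × ℝ) × ℝ, ‖(if 0 ≤ p.1.2 + p.2 then D p.1.1 * Q p.2 else 0)‖ ≤ 
     l/2 * D p.1.1^2 + 1/(2*l) * Q p.2^2 := by
    intro p
    have h0 : 0 ≤ l/2 * D p.1.1^2 + 1/(2*l) * Q p.2^2 := by positivity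
    split_ifs
    · rw [Real.norm_eq_abs, abs_mul]
      have : l/2 * D p.1.1^2 + 1/(2*l) * Q p.2^2 - |D p.1.1| * |Q p.2| = 
          (l * |D p.1.1| - |Q p.2|)^2 / (2*l) := by
        rw [← sq_abs (D p.1.1), ← sq_abs (Q p.2)]; field_simp; ring
      have h2 : 0 ≤ (l * |D p.1.1| - |Q p.2|)^2 / (2*l) := by positivity
      linarith
    · simpa using h0
  constructor
  · exact (i1.add i2).mono' (meas_ite _ hm).aestronglyMeasurable (Filter.Eventually.of_forall bd)
  · have := norm_integral_le_of_norm_le (i1.add i2) (Filter.Eventually.of_forall bd)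
    rw [integral_add' i1 i2, integral_const_mul, integral_const_mul] at this
    have e1 : ∫ p, ((fun a => D a^2) ∘ fun p : (ℝ × ℝ) × ℝ => p.1.1) p ∂((muR ρ s).prod G) = ∫ a, D a^2 ∂G := by
      conv_rhs => rw [← T1.map_eq, integral_map T1.measurable.aemeasurable (by fun_prop)]
      rfl
    have e2 : ∫ p, ((fun a => Q a^2) ∘ fun p : (ℝ × ℝ) × ℝ => p.2) p ∂((muR ρ s).prod G) = ∫ a, Q a^2 ∂G := by
      conv_rhs => rw [← T2.map_eq, integral_map T2.measurable.aemeasurable (by fun_prop)]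
      rfl
    rw [e1, e2] at this
    refine le_trans this (le_of_eq ?_)
    field_simp

lemma integrable_ite_of_bdd (ρ s : ℝ) (h : ℝ → ℝ → ℝ) (hm : Measurable (Function.uncurry h)) (C : ℝ)
    (hC : ∀ a b, |h a b| ≤ C) : 
    Integrable (fun p : (ℝ × ℝ) × ℝ => if 0 ≤ p.1.2 + p.2 then h p.1.1 p.2 else 0) ((muR ρ s).prod G) := by
  refine Integrable.of_bound (meas_ite h hm).aestronglyMeasurable C (Filter.Eventually.of_forall fun p => ?_)
  split_ifs
  · exact hC _ _
  · simpa using (abs_nonneg _).trans (hC 0 0)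

lemma hh_err {ε : ℝ} (hε : 0 < ε) (hε1 : ε ≤ 1) (ρ s : ℝ) (hs : ρ^2 + s^2 = 1) (i : ℕ) :
    |J ρ s (hh ε i) - ρ^i| ≤ 10^4 * ε^2 * ((i:ℝ)+1) := by
  cases i with
  | zero => 
    have : J ρ s (hh ε 0) = 1 := J_const ρ s
    rw [this]; simp; positivity
  | succ n =>
    have hB := BB_one hε hε1 n
    obtain ⟨i1, -, h, -⟩ := trunc ε hε hε1 (n+1) (BB ε (n+1)) (by linarith) (BB_sq hε hε1 _)
    have c1 := (continuous_He (n+1))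
    have c2 := continuous_cl (BB ε (n+1))
    have hf : (0:ℝ) < n.factorial := by positivity
    obtain ⟨k1, k2⟩ := J_err ρ s hs (fun a => He (n+1) a - He (n+1) (cl (BB ε (n+1)) a)) (q n)
      (by fun_prop) (meas_q n) i1 (integrable_q_sq n) (1/(n.factorial * ε^2)) (by positivity)
    have k3 := integrable_ite_of_bdd ρ s (hh ε (n+1)) (meas_hh ε (n+1)) _ (hh_sup hε hε1 (n+1))
    have e : J ρ s (fun a b => He (n+1) a * q n b) = 
        J ρ s (fun a b => (He (n+1) a - He (n+1) (cl (BB ε (n+1)) a)) * q n b) + J ρ s (hh ε (n+1)) := by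
      unfold J
      rw [← integral_add k1 k3]
      congr 1; ext p
      split_ifs
      · simp only [hh]; ring
      · simp
    rw [J_He ρ s hs n (q n) (meas_q n) (integrable_q n), q_norm, mul_one] at e
    rw [e, abs_sub_comm, add_sub_cancel_right]
    refine k2.trans ?_
    have h3 := inv_NN n
    have hN := NN_pos n
    have hn : (0:ℝ) ≤ n := by positivity
    have hq := q_sq n
    calc _ ≤ (1/(n.factorial * ε^2) * (6 * (n+1).factorial * ε^4) + (86 / NN n) / (1/(n.factorial * ε^2)))/2 := by
          gcongr
      _ = (6 * (n+1) * ε^2 + 86 * n.factorial * ε^2 * (1/NN n))/2 := by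
          rw [Nat.factorial_succ]; push_cast; field_simp
      _ ≤ (6 * (n+1) * ε^2 + 86 * n.factorial * ε^2 * ((15/16) * (3*n+25) / n.factorial))/2 := by gcongr
      _ = (6 * (n+1) + 86 * ((15/16) * (3*n+25)))/2 * ε^2 := by field_simp
      _ ≤ 10^4 * (((n+1:ℕ):ℝ)+1) * ε^2 := by gcongr; push_cast; linarith
      _ = _ := by ring

/-- number of terms kept -/
noncomputable def Nn (ε : ℝ) : ℕ := ⌊1/(10^4 * ε^2)⌋₊

lemma Nn_small {ε : ℝ} (hε : 0 < ε) {i : ℕ} (hi : i < Nn ε) : ε ≤ 1 := by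
  have h1 : 1 ≤ Nn ε := by omega
  rw [Nn, Nat.one_le_floor_iff, le_div_iff₀ (by positivity)] at h1
  nlinarith

lemma Nn_large {ε : ℝ} (hε : 0 < ε) {i : ℕ} (hi : ¬ i < Nn ε) : 1 ≤ 10^4 * ε^2 * ((i:ℝ)+1) := by
  have h1 : Nn ε < i + 1 := by omega
  rw [Nn, Nat.floor_lt (by positivity), div_lt_iff₀ (by positivity)] at h1
  push_cast at h1; linarith

/-- the function of the lemma -/
noncomputable def HF (c : ℕ → ℝ) (ε : ℝ) (a b : ℝ) : ℝ :=
  ∑ i ∈ Finset.range (Nn ε), c i * hh ε i a b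

lemma meas_HF (c : ℕ → ℝ) (ε : ℝ) : Measurable (Function.uncurry (HF c ε)) := by
  have : Function.uncurry (HF c ε) = fun v => ∑ i ∈ Finset.range (Nn ε), c i * Function.uncurry (hh ε i) v := by
    ext v; rfl
  rw [this]
  exact Finset.measurable_fun_sum _ fun i _ => (meas_hh ε i).const_mul _

lemma ce_nonneg (c : ℕ → ℝ) (ε : ℝ) (i : ℕ) : 0 ≤ ceSummand c 1 ε i := by
  unfold ceSummand Cstar; positivity

lemma ce_eq (c : ℕ → ℝ) (ε : ℝ) (i : ℕ) : ceSummand c 1 ε i = 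
    |c i| * ((10^4:ℝ)^i + (Real.sqrt (Real.log (1/ε)) / Real.sqrt i * 10^4)^i) := by
  unfold ceSummand Cstar; rw [mul_one, mul_comm]

lemma cs_ge (c : ℕ → ℝ) (i : ℕ) : |c i| * ((i:ℝ)+1) ≤ csSummand c 1 i := by
  unfold csSummand
  rw [one_pow, mul_one, mul_comm]
  gcongr
  exact Real.self_le_rpow_of_one_le (by have : (0:ℝ) ≤ i := by positivity
                                        linarith) (by norm_num)

lemma cs_nonneg (c : ℕ → ℝ) (i : ℕ) : 0 ≤ csSummand c 1 i := le_trans (by positivity) (cs_ge c i)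

lemma HF_sup (c : ℕ → ℝ) (ε : ℝ) (hε0 : 0 < ε) (hCeSum : Summable (ceSummand c 1 ε)) (a b : ℝ) :
    |HF c ε a b| ≤ ceOf c 1 ε := by
  refine (Finset.abs_sum_le_sum_abs _ _).trans (le_trans (Finset.sum_le_sum fun i hi => ?_)
    (hCeSum.sum_le_tsum (Finset.range (Nn ε)) fun i _ => ce_nonneg c ε i))
  rw [abs_mul, ce_eq]
  gcongr
  exact hh_sup hε0 (Nn_small hε0 (Finset.mem_range.1 hi)) i a b

lemma HF_lip (c : ℕ → ℝ) (ε : ℝ) (hε0 : 0 < ε) (hCeSum : Summable (ceSummand c 1 ε)) (a a' b : ℝ) :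
    |HF c ε a b - HF c ε a' b| ≤ ceOf c 1 ε * |a - a'| := by
  unfold HF
  rw [← Finset.sum_sub_distrib]
  have h1 : ∑ i ∈ Finset.range (Nn ε), ceSummand c 1 ε i * |a - a'| ≤ ceOf c 1 ε * |a - a'| := by
    rw [← Finset.sum_mul]
    exact mul_le_mul_of_nonneg_right
      (hCeSum.sum_le_tsum (Finset.range (Nn ε)) fun i _ => ce_nonneg c ε i) (abs_nonneg _)
  refine (Finset.abs_sum_le_sum_abs _ _).trans (le_trans (Finset.sum_le_sum fun i hi => ?_) h1)
  rw [← mul_sub, abs_mul, ce_eq, mul_assoc]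
  gcongr
  exact hh_lip hε0 (Nn_small hε0 (Finset.mem_range.1 hi)) i a a' b

lemma J_HF (c : ℕ → ℝ) (ε : ℝ) (hε0 : 0 < ε) (ρ s : ℝ) :
    J ρ s (HF c ε) = ∑ i ∈ Finset.range (Nn ε), c i * J ρ s (hh ε i) := by
  unfold J
  have e : ∀ p : (ℝ × ℝ) × ℝ, (if 0 ≤ p.1.2 + p.2 then HF c ε p.1.1 p.2 else 0) = 
      ∑ i ∈ Finset.range (Nn ε), c i * (if 0 ≤ p.1.2 + p.2 then hh ε i p.1.1 p.2 else 0) := by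
    intro p; split_ifs
    · rfl
    · simp
  simp_rw [e]
  rw [integral_finsetSum]
  · simp_rw [integral_const_mul]
  · intro i hi
    exact (integrable_ite_of_bdd ρ s _ (meas_hh ε i) _ 
      (hh_sup hε0 (Nn_small hε0 (Finset.mem_range.1 hi)) i)).const_mul _

lemma cs_pos (c : ℕ → ℝ) (ε : ℝ) (hε0 : 0 < ε) (hε : ε < 1 / csOf c 1) : 0 < csOf c 1 :=
  one_div_pos.1 (hε0.trans hε)

lemma HF_err (c : ℕ → ℝ) (hCsSum : Summable (csSummand c 1))
    (ε : ℝ) (hε0 : 0 < ε) (hε : ε < 1 / csOf c 1) (ρ s : ℝ) (hs : ρ^2 + s^2 = 1) :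
    |J ρ s (HF c ε) - psVal c ρ| ≤ ε := by
  have hρ : |ρ| ≤ 1 := by
    rw [← sq_le_one_iff_abs_le_one]; nlinarith [sq_nonneg s]
  have hsum : Summable (fun i => c i * ρ^i) := by
    refine Summable.of_norm_bounded hCsSum fun i => ?_
    rw [norm_mul, norm_pow, Real.norm_eq_abs, Real.norm_eq_abs]
    refine le_trans ?_ (cs_ge c i)
    gcongr
    have : (0:ℝ) ≤ i := by positivity
    linarith [pow_le_one₀ (abs_nonneg ρ) hρ (n := i)]
  set d : ℕ → ℝ := fun i => if i < Nn ε then c i * J ρ s (hh ε i) else 0 with hd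
  have hds : HasSum d (J ρ s (HF c ε)) := by
    have h1 : ∑ i ∈ Finset.range (Nn ε), d i = J ρ s (HF c ε) := by
      rw [J_HF c ε hε0]
      refine Finset.sum_congr rfl fun i hi => ?_
      simp [hd, Finset.mem_range.1 hi]
    rw [← h1]
    refine hasSum_sum_of_ne_finset_zero fun i hi => ?_
    rw [Finset.mem_range] at hi
    simp [hd, hi]
  have hdiff := hds.sub hsum.hasSum
  have hb : ∀ i, ‖d i - c i * ρ^i‖ ≤ (10^4*ε^2) * csSummand c 1 i := by
    intro i
    have h1 : ‖d i - c i * ρ^i‖ ≤ |c i| * (10^4*ε^2 * ((i:ℝ)+1)) := by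
      simp only [hd]
      split_ifs with h
      · rw [← mul_sub, norm_mul, Real.norm_eq_abs, Real.norm_eq_abs]
        gcongr
        exact hh_err hε0 (Nn_small hε0 h) ρ s hs i
      · rw [zero_sub, norm_neg, norm_mul, norm_pow, Real.norm_eq_abs, Real.norm_eq_abs]
        gcongr
        exact (pow_le_one₀ (abs_nonneg ρ) hρ).trans (Nn_large hε0 h)
    calc _ ≤ _ := h1
      _ = (10^4*ε^2) * (|c i| * ((i:ℝ)+1)) := by ring
      _ ≤ _ := by gcongr; exact cs_ge c i
  have := tsum_of_norm_bounded (hCsSum.hasSum.mul_left (10^4*ε^2)) hb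
  rw [hdiff.tsum_eq] at this
  have hpos := cs_pos c ε hε0 hε
  rw [lt_div_iff₀ hpos] at hε
  calc _ ≤ _ := this
    _ = ε * (ε * csOf c 1) := by unfold csOf Cstar; ring
    _ ≤ ε * 1 := by gcongr
    _ = ε := mul_one _

lemma HF_sq (c : ℕ → ℝ) (hCsSum : Summable (csSummand c 1))
    (ε : ℝ) (hε0 : 0 < ε) :
    (∫ v : ℝ × ℝ, (HF c ε v.1 v.2) ^ 2 ∂(G.prod G)) ≤ (csOf c 1) ^ 2 := by
  set t : ℕ → ℝ := fun i => 10^4 * ((i:ℝ)+1) with ht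
  have ht0 : ∀ i, 0 < t i := fun i => by simp only [ht]; positivity
  set S := ∑ i ∈ Finset.range (Nn ε), |c i| * t i with hS
  have hS0 : 0 ≤ S := Finset.sum_nonneg fun i _ => mul_nonneg (abs_nonneg _) (ht0 i).le
  have hSle : S ≤ csOf c 1 := by
    unfold csOf Cstar
    refine le_trans ?_ (mul_le_mul_of_nonneg_left 
      (hCsSum.sum_le_tsum (Finset.range (Nn ε)) fun i _ => cs_nonneg c i) (by norm_num))
    rw [Finset.mul_sum]
    refine Finset.sum_le_sum fun i _ => ?_
    have := cs_ge c i
    simp only [ht]; linarith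
  have hint : ∀ i ∈ Finset.range (Nn ε), 
      Integrable (fun v : ℝ × ℝ => (|c i| / t i) * (hh ε i v.1 v.2)^2) (G.prod G) := by
    intro i hi
    refine Integrable.const_mul ?_ _
    refine Integrable.of_bound ((meas_hh ε i).pow_const 2).aestronglyMeasurable
      (((10^4:ℝ)^i + (Real.sqrt (Real.log (1/ε)) / Real.sqrt i * 10^4)^i)^2)
      (Filter.Eventually.of_forall fun v => ?_)
    · rw [norm_pow]; gcongr
      exact hh_sup hε0 (Nn_small hε0 (Finset.mem_range.1 hi)) i v.1 v.2
  have hpt : ∀ v : ℝ × ℝ, (HF c ε v.1 v.2)^2 ≤ 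
      S * ∑ i ∈ Finset.range (Nn ε), (|c i| / t i) * (hh ε i v.1 v.2)^2 := by
    intro v
    refine Finset.sum_sq_le_sum_mul_sum_of_sq_le_mul _ (fun i _ => mul_nonneg (abs_nonneg _) (ht0 i).le) 
      (fun i _ => mul_nonneg (div_nonneg (abs_nonneg _) (ht0 i).le) (sq_nonneg _)) (fun i _ => ?_)
    have := (ht0 i).ne'
    refine le_of_eq ?_
    rw [mul_pow, ← sq_abs (c i)]; field_simp
  have hI := (integrable_finsetSum _ hint).const_mul S
  have h1 : ∫ v : ℝ × ℝ, (HF c ε v.1 v.2) ^ 2 ∂(G.prod G) ≤ 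
      ∫ v : ℝ × ℝ, S * ∑ i ∈ Finset.range (Nn ε), (|c i| / t i) * (hh ε i v.1 v.2)^2 ∂(G.prod G) :=
    integral_mono_of_nonneg (Filter.Eventually.of_forall fun v => sq_nonneg _) hI 
      (Filter.Eventually.of_forall hpt)
  rw [integral_const_mul, integral_finsetSum _ hint] at h1
  calc _ ≤ _ := h1
    _ ≤ S * S := by
        gcongr
        refine Finset.sum_le_sum fun i hi => ?_
        rw [integral_const_mul]
        have h2 := hh_sq hε0 (Nn_small hε0 (Finset.mem_range.1 hi)) i
        have := ht0 i
        calc _ ≤ |c i| / t i * (t i)^2 := by gcongr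
          _ = _ := by field_simp
    _ ≤ csOf c 1 ^2 := by rw [sq]; exact mul_le_mul hSle hSle hS0 (hS0.trans hSle)

end ITF

/-- **Indicator-to-function lemma.** For a power series `φ` and `ε ∈ (0, 1/𝔠_s(φ,1))` with
`𝔠_ε(φ,1) < ∞`, there is a bounded function `h : ℝ² → [−𝔠_ε(φ,1), 𝔠_ε(φ,1)]`, Lipschitz in its
first coordinate, such that `E[1{α₁x₁ + β₁√(1−x₁²) + b₀ ≥ 0} h(α₁,b₀)]` approximates `φ(x₁)` up
to `ε` (equivalently in the vector form), and `E[h(α₁,b₀)²] ≤ 𝔠_s(φ,1)²`. -/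
theorem indicator_to_function
    (c : ℕ → ℝ)
    (hCsSum : Summable (csSummand c 1))
    (ε : ℝ) (hε0 : 0 < ε) (hε : ε < 1 / csOf c 1)
    (hCeSum : Summable (ceSummand c 1 ε)) :
    ∃ h : ℝ → ℝ → ℝ,
      (∀ a b, |h a b| ≤ ceOf c 1 ε) ∧
      (∀ a a' b, |h a b - h a' b| ≤ ceOf c 1 ε * |a - a'|) ∧
      -- (a) scalar form
      (∀ x₁ ∈ Set.Icc (-1 : ℝ) 1,
        |(∫ v : ℝ × ℝ × ℝ,
            (if 0 ≤ v.1 * x₁ + v.2.1 * Real.sqrt (1 - x₁ ^ 2) + v.2.2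
              then h v.1 v.2.2 else 0)
            ∂((gaussianReal 0 1).prod ((gaussianReal 0 1).prod (gaussianReal 0 1))))
          - psVal c x₁| ≤ ε) ∧
      -- (b) vector form
      (∀ d : ℕ, 1 ≤ d → ∀ w x : Fin d → ℝ,
        (∑ j, (w j) ^ 2) = 1 → (∑ j, (x j) ^ 2) = 1 →
        |(∫ v : (Fin d → ℝ) × ℝ,
            (if 0 ≤ (∑ j, v.1 j * x j) + v.2 then h (∑ j, v.1 j * w j) v.2 else 0)
            ∂((Measure.pi fun _ : Fin d => gaussianReal 0 1).prod (gaussianReal 0 1)))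
          - psVal c (∑ j, w j * x j)| ≤ ε) ∧
      -- second moment bound
      (∫ v : ℝ × ℝ, (h v.1 v.2) ^ 2 ∂((gaussianReal 0 1).prod (gaussianReal 0 1)))
        ≤ (csOf c 1) ^ 2 := by
  have key : ∀ ρ : ℝ, ρ^2 ≤ 1 → ρ^2 + Real.sqrt (1 - ρ^2)^2 = 1 := by
    intro ρ h
    rw [Real.sq_sqrt (by linarith)]; ring
  refine ⟨ITF.HF c ε, ITF.HF_sup c ε hε0 hCeSum, ITF.HF_lip c ε hε0 hCeSum, ?_, ?_,
    ITF.HF_sq c hCsSum ε hε0⟩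
  · intro x hx
    have hs := key x (by nlinarith [hx.1, hx.2])
    have := ITF.J_a x _ hs (ITF.HF c ε) (ITF.meas_HF c ε)
    rw [this]
    exact ITF.HF_err c hCsSum ε hε0 hε x _ hs
  · intro d _ w x hw hx
    have hcs := Finset.sum_mul_sq_le_sq_mul_sq Finset.univ w x
    rw [hw, hx, mul_one] at hcs
    have hs := key _ hcs
    have := ITF.J_b w x hw hx _ hs (ITF.HF c ε) (ITF.meas_HF c ε)
    rw [this]
    exact ITF.HF_err c hCsSum ε hε0 hε _ _ hs
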